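/- For any strictly positive joint distribution p on C × K, the plug-in estimator equals the mutual information, I_est(p) = I(p), if and only if p factorizes, i.e. p(c,k) = p_C(c)·p_K(k) for all (c,k). -/

import Mathlib

open Finset

/-- Marginal on the first coordinate: `p_C(c) = ∑ₖ p(c,k)`. -/
noncomputable def margC {C K : Type*} [Fintype K] (p : C × K → ℝ) (c : C) : ℝ :=
  ∑ k, p (c, k)

/-- Marginal on the second coordinate: `p_K(k) = ∑_c p(c,k)`. -/
noncomputable def margK {C K : Type*} [Fintype C] (p : C × K → ℝ) (k : K) : ℝ :=
  ∑ c, p (c, k)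

/-- Conditional distribution: `p(k|c) = p(c,k) / p_C(c)`. -/
noncomputable def condK {C K : Type*} [Fintype K] (p : C × K → ℝ) (c : C) (k : K) : ℝ :=
  p (c, k) / margC p c

/-- Mutual information `I(p) = ∑_{(c,k)} p(c,k) log (p(c,k) / (p_C(c) p_K(k)))`. -/
noncomputable def mutInfo {C K : Type*} [Fintype C] [Fintype K] (p : C × K → ℝ) : ℝ :=
  ∑ ck : C × K, p ck * Real.log (p ck / (margC p ck.1 * margK p ck.2))

/-- The plug-in estimator
`I_est(p) = ∑ p(c,k) log p(k|c) − ∑ p_C(c) p_K(k) log p(k|c)`. -/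
noncomputable def Iest {C K : Type*} [Fintype C] [Fintype K] (p : C × K → ℝ) : ℝ :=
  (∑ ck : C × K, p ck * Real.log (condK p ck.1 ck.2)) -
    ∑ ck : C × K, margC p ck.1 * margK p ck.2 * Real.log (condK p ck.1 ck.2)

/-- The variational estimator, for `q (c,k) = q(k|c)` a conditional distribution:
`I_θ(p,q) = ∑ p(c,k) log q(k|c) − ∑ p_C(c) p_K(k) log q(k|c)`. -/
noncomputable def Itheta {C K : Type*} [Fintype C] [Fintype K] (p q : C × K → ℝ) : ℝ :=
  (∑ ck : C × K, p ck * Real.log (q ck)) -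
    ∑ ck : C × K, margC p ck.1 * margK p ck.2 * Real.log (q ck)

/-- Kullback–Leibler divergence of finitely supported positive distributions. -/
noncomputable def KLdiv {A : Type*} [Fintype A] (r s : A → ℝ) : ℝ :=
  ∑ a, r a * Real.log (r a / s a)

open InformationTheory in
/-- Equality case of the Gibbs inequality. -/
theorem KLdiv_eq_zero_iff {A : Type*} [Fintype A] {r s : A → ℝ} (hr : ∀ a, 0 < r a)
    (hs : ∀ a, 0 < s a) (hrs : ∑ a, r a = ∑ a, s a) : KLdiv r s = 0 ↔ ∀ a, s a = r a := by
  have hkl : KLdiv r s = ∑ a, s a * klFun (r a / s a) := by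
    have hterm (a : A) : s a * klFun (r a / s a) = r a * Real.log (r a / s a) + (s a - r a) := by
      have := (hs a).ne'
      rw [klFun]
      field_simp
      ring
    simp_rw [hterm, sum_add_distrib, sum_sub_distrib, hrs, sub_self, add_zero, KLdiv]
  have hdiv (a : A) : 0 ≤ r a / s a := (div_pos (hr a) (hs a)).le
  rw [hkl, sum_eq_zero_iff_of_nonneg fun a _ => mul_nonneg (hs a).le (klFun_nonneg (hdiv a))]
  simp [(hs _).ne', klFun_eq_zero_iff (hdiv _), div_eq_one_iff_eq, eq_comm]

theorem margC_pos {C K : Type*} [Fintype K] [Nonempty K] {p : C × K → ℝ}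
    (hpos : ∀ ck, 0 < p ck) (c : C) : 0 < margC p c :=
  sum_pos (fun _ _ => hpos _) univ_nonempty

theorem margK_pos {C K : Type*} [Fintype C] [Nonempty C] {p : C × K → ℝ}
    (hpos : ∀ ck, 0 < p ck) (k : K) : 0 < margK p k :=
  sum_pos (fun _ _ => hpos _) univ_nonempty

section Marginals

variable {C K : Type*} [Fintype C] [Fintype K] {p : C × K → ℝ}

theorem sum_margC (p : C × K → ℝ) : ∑ c, margC p c = ∑ ck, p ck :=
  (Fintype.sum_prod_type p).symm

/-- A function of the second coordinate has the same mean under `p` and under the product of the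
marginals of `p`. -/
theorem sum_mul_snd_eq_sum_margC_mul_margK_mul (hsum : ∑ ck : C × K, p ck = 1) (f : K → ℝ) :
    ∑ ck : C × K, p ck * f ck.2 = ∑ ck : C × K, margC p ck.1 * margK p ck.2 * f ck.2 := by
  have hleft : ∑ ck : C × K, p ck * f ck.2 = ∑ k, margK p k * f k := by
    simp_rw [Fintype.sum_prod_type_right, margK, sum_mul]
  simp_rw [hleft, Fintype.sum_prod_type, mul_assoc, ← mul_sum, ← sum_mul, sum_margC, hsum,
    one_mul]

theorem sum_margC_mul_margK (hsum : ∑ ck : C × K, p ck = 1) :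
    ∑ ck : C × K, margC p ck.1 * margK p ck.2 = ∑ ck, p ck := by
  simpa using (sum_mul_snd_eq_sum_margC_mul_margK_mul hsum fun _ => 1).symm

/-- The bias of the plug-in estimator is the divergence of the product of the marginals from the
joint distribution. -/
theorem Iest_sub_mutInfo [Nonempty C] [Nonempty K] (hpos : ∀ ck, 0 < p ck)
    (hsum : ∑ ck : C × K, p ck = 1) :
    Iest p - mutInfo p = KLdiv (fun ck => margC p ck.1 * margK p ck.2) p := by
  have hC (c : C) := (margC_pos hpos c).ne'
  have hK (k : K) := (margK_pos hpos k).ne'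
  have hp (ck : C × K) := (hpos ck).ne'
  have hcond (ck : C × K) :
      Real.log (condK p ck.1 ck.2) = Real.log (p ck) - Real.log (margC p ck.1) :=
    Real.log_div (hp _) (hC _)
  have hmean := sum_mul_snd_eq_sum_margC_mul_margK_mul hsum fun k => Real.log (margK p k)
  simp only [Iest, mutInfo, KLdiv, hcond, Real.log_div (hp _) (mul_ne_zero (hC _) (hK _)),
    Real.log_div (mul_ne_zero (hC _) (hK _)) (hp _), Real.log_mul (hC _) (hK _), mul_sub, mul_add,
    sum_sub_distrib, sum_add_distrib]
  linarith

end Marginals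

/-- **Equality case of Proposition 1.1 (discrete form).** The plug-in estimator equals the
mutual information iff the joint distribution factorizes. -/
theorem Iest_eq_mutInfo_iff_indep {C K : Type*} [Fintype C] [Fintype K] [Nonempty C] [Nonempty K]
    (p : C × K → ℝ) (hpos : ∀ ck, 0 < p ck) (hsum : ∑ ck : C × K, p ck = 1) :
    Iest p = mutInfo p ↔ ∀ ck : C × K, p ck = margC p ck.1 * margK p ck.2 := by
  rw [← sub_eq_zero, Iest_sub_mutInfo hpos hsum]
  exact KLdiv_eq_zero_iff (fun ck => mul_pos (margC_pos hpos ck.1) (margK_pos hpos ck.2)) hpos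
    (sum_margC_mul_margK hsum)
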